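/- Let A be a symmetric n×n real matrix that is Robinsonian and let σ, τ be two SFS orderings of A. If x <_τ y <_τ z and z <_σ y <_σ x, then the triple (x, y, z) is Robinson, i.e., A_{xz} ≤ min(A_{xy}, A_{yz}). -/

import Mathlib

/-- `π` is a Robinson ordering of the symmetric matrix `A`: entries are monotone
nondecreasing towards the diagonal. Here `π x` is the position of vertex `x`. -/
def IsRobinsonOrdering {n : ℕ} (A : Matrix (Fin n) (Fin n) ℝ)
    (π : Equiv.Perm (Fin n)) : Prop :=
  ∀ x y z : Fin n, π x < π y → π y < π z → A x z ≤ min (A x y) (A y z)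

/-- `A` is Robinsonian: it admits a Robinson ordering. -/
def IsRobinsonian {n : ℕ} (A : Matrix (Fin n) (Fin n) ℝ) : Prop :=
  ∃ π : Equiv.Perm (Fin n), IsRobinsonOrdering A π

/-- There is a path from `x` to `z` avoiding `y`: a sequence `x = v 0, v 1, ..., v k = z`
with `A (v i) (v (i+1)) > min (A y (v i)) (A y (v (i+1)))` for all `i < k`. -/
def PathAvoiding {n : ℕ} (A : Matrix (Fin n) (Fin n) ℝ) (x y z : Fin n) : Prop :=
  ∃ (k : ℕ) (v : ℕ → Fin n), v 0 = x ∧ v k = z ∧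
    ∀ i < k, min (A y (v i)) (A y (v (i + 1))) < A (v i) (v (i + 1))

/-- `z` is valid: for no pair of distinct vertices `u, v ≠ z` there exist both a path
from `u` to `z` avoiding `v` and a path from `v` to `z` avoiding `u`. -/
def IsValid {n : ℕ} (A : Matrix (Fin n) (Fin n) ℝ) (z : Fin n) : Prop :=
  ∀ u v : Fin n, u ≠ v → u ≠ z → v ≠ z →
    ¬ (PathAvoiding A u v z ∧ PathAvoiding A v u z)

/-- `a` is the first element of the linear order `π`. -/
def IsFirstOf {n : ℕ} (π : Equiv.Perm (Fin n)) (a : Fin n) : Prop :=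
  ∀ y : Fin n, π a ≤ π y

/-- `a` is the last element of the linear order `π`. -/
def IsLastOf {n : ℕ} (π : Equiv.Perm (Fin n)) (a : Fin n) : Prop :=
  ∀ y : Fin n, π y ≤ π a

/-- `a` is an anchor of `A`: some Robinson ordering of `A` ends with `a`. -/
def IsAnchor {n : ℕ} (A : Matrix (Fin n) (Fin n) ℝ) (a : Fin n) : Prop :=
  ∃ π : Equiv.Perm (Fin n), IsRobinsonOrdering A π ∧ IsLastOf π a

/-- `a, b` are opposite anchors of `A`: some Robinson ordering starts with `a` and
ends with `b`. -/
def OppositeAnchors {n : ℕ} (A : Matrix (Fin n) (Fin n) ℝ) (a b : Fin n) : Prop :=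
  ∃ π : Equiv.Perm (Fin n), IsRobinsonOrdering A π ∧ IsFirstOf π a ∧ IsLastOf π b

/-- `σ` is an SFS ordering of `A` (3-point characterization): whenever
`x <_σ y <_σ z` and `A x z > A x y`, some `u <_σ x` has `A u y > A u z`. -/
def IsSFSOrdering {n : ℕ} (A : Matrix (Fin n) (Fin n) ℝ)
    (σ : Equiv.Perm (Fin n)) : Prop :=
  ∀ x y z : Fin n, σ x < σ y → σ y < σ z → A x y < A x z →
    ∃ u : Fin n, σ u < σ x ∧ A u z < A u y

/-- `σ` is an SFS₊ ordering of `A` with respect to `τ`: it is an SFS ordering and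
ties are broken according to `τ` (whenever `y <_σ z` are tied, `z <_τ y`). -/
def IsSFSPlus {n : ℕ} (A : Matrix (Fin n) (Fin n) ℝ)
    (τ σ : Equiv.Perm (Fin n)) : Prop :=
  IsSFSOrdering A σ ∧
    ∀ y z : Fin n, σ y < σ z → (∀ u : Fin n, σ u < σ y → A u y = A u z) → τ z < τ y

/-- `σ` is a good SFS ordering of `A`: it is an SFS ordering whose first element is
the last element of some SFS ordering of `A`. -/
def IsGoodSFS {n : ℕ} (A : Matrix (Fin n) (Fin n) ℝ)
    (σ : Equiv.Perm (Fin n)) : Prop :=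
  IsSFSOrdering A σ ∧
    ∃ b : Fin n, IsFirstOf σ b ∧ ∃ τ : Equiv.Perm (Fin n), IsSFSOrdering A τ ∧ IsLastOf τ b

/-- The union `L_0 ∪ L_1 ∪ ... ∪ L_i` of the similarity layers of `A` rooted at `a`. -/
def simLayerUnion {n : ℕ} (A : Matrix (Fin n) (Fin n) ℝ) (a : Fin n) : ℕ → Set (Fin n)
  | 0 => {a}
  | i + 1 => simLayerUnion A a i ∪
      {y | y ∉ simLayerUnion A a i ∧
        ∀ x ∈ simLayerUnion A a i, ∀ z ∉ simLayerUnion A a i, A x z ≤ A x y}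

/-- The `i`th similarity layer `L_i` of `A` rooted at `a`: `L_0 = {a}` and
`L_{i+1} = {y ∉ L_0 ∪ ... ∪ L_i : A x y ≥ A x z for all x ∈ L_0 ∪ ... ∪ L_i and
z ∉ L_0 ∪ ... ∪ L_i}`. -/
def simLayer {n : ℕ} (A : Matrix (Fin n) (Fin n) ℝ) (a : Fin n) : ℕ → Set (Fin n)
  | 0 => {a}
  | i + 1 => {y | y ∉ simLayerUnion A a i ∧
      ∀ x ∈ simLayerUnion A a i, ∀ z ∉ simLayerUnion A a i, A x z ≤ A x y}

def AvE {n : ℕ} (A : Matrix (Fin n) (Fin n) ℝ) (m a b : Fin n) : Prop :=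
  a ≠ m ∧ b ≠ m ∧ min (A m a) (A m b) < A a b

lemma first_disc {n : ℕ} (A : Matrix (Fin n) (Fin n) ℝ)
    (τ : Equiv.Perm (Fin n)) (hτ : IsSFSOrdering A τ) (p z : Fin n) (hpz : τ p < τ z)
    (t : Fin n) (htp : τ t < τ p) (ht : A t z < A t p) :
    ∃ s, τ s ≤ τ t ∧ A s z < A s p ∧ ∀ r, τ r < τ s → A r p = A r z := by
  obtain ⟨s, hs, hmin⟩ := Set.exists_min_image {s : Fin n | A s p ≠ A s z} τ
    (Set.toFinite _) ⟨t, ht.ne'⟩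
  have h1 := hmin t ht.ne'
  have h2 : ∀ r, τ r < τ s → A r p = A r z := by
    intro r hr
    by_contra h
    exact absurd (hmin r h) (not_le.mpr hr)
  refine ⟨s, h1, ?_, h2⟩
  by_contra h
  have h3 : A s p < A s z := lt_of_le_of_ne (not_lt.mp h) hs
  obtain ⟨u, hu, hu2⟩ := hτ s p z (lt_of_le_of_lt h1 htp) hpz h3
  exact hu2.ne' (h2 u hu)

lemma descent {n : ℕ} (A : Matrix (Fin n) (Fin n) ℝ) (hA : A.IsSymm)
    (τ : Equiv.Perm (Fin n)) (hτ : IsSFSOrdering A τ) (z : Fin n) :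
    ∀ k : ℕ, ∀ s p q : Fin n, (τ s : ℕ) = k → τ s < τ q → τ q < τ p → τ p < τ z →
      A s z < A s p → (∀ r, τ r < τ s → A r p = A r z) →
      Relation.EqvGen (AvE A z) q p := by
  intro k
  induction k using Nat.strong_induction_on with
  | _ k ih =>
  intro s p q hk hsq hqp hpz hsp hfirst
  have hqz : τ q < τ z := hqp.trans hpz
  have hsz : τ s < τ z := hsq.trans hqz
  have nes : s ≠ z := fun h => hsz.ne (by rw [h])
  have neq : q ≠ z := fun h => hqz.ne (by rw [h])
  have nep : p ≠ z := fun h => hpz.ne (by rw [h])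
  have esp : AvE A z s p := ⟨nes, nep, by
    rw [hA.apply s z]; exact lt_of_le_of_lt (min_le_left _ _) hsp⟩
  by_cases h : A s q ≤ A s z
  · obtain ⟨t, hts, ht⟩ := hτ s q p hsq hqp (lt_of_le_of_lt h hsp)
    rw [hfirst t hts] at ht
    obtain ⟨t', h1, h2, h3⟩ := first_disc A τ hτ q z hqz t (hts.trans hsq) ht
    have h4 : τ t' < τ s := lt_of_le_of_lt h1 hts
    have := ih (τ t') (by rw [← hk]; exact h4) t' q s rfl h4 hsq hqz h2 h3
    exact (this.symm).trans _ _ _ (.rel _ _ esp)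
  · have esq : AvE A z s q := ⟨nes, neq, by
      rw [hA.apply s z]; exact lt_of_le_of_lt (min_le_left _ _) (not_le.mp h)⟩
    exact (Relation.EqvGen.symm _ _ (.rel _ _ esq)).trans _ _ _ (.rel _ _ esp)

lemma sfs_path {n : ℕ} (A : Matrix (Fin n) (Fin n) ℝ) (hA : A.IsSymm)
    (τ : Equiv.Perm (Fin n)) (hτ : IsSFSOrdering A τ) (x y z : Fin n)
    (hxy : τ x < τ y) (hyz : τ y < τ z) (h : A x y < A x z) :
    Relation.EqvGen (AvE A z) x y := by
  obtain ⟨u, hu, hu2⟩ := hτ x y z hxy hyz h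
  obtain ⟨s, h1, h2, h3⟩ := first_disc A τ hτ y z hyz u (hu.trans hxy) hu2
  exact descent A hA τ hτ z _ s y x rfl (lt_of_le_of_lt h1 hu) hxy hyz h2 h3

lemma avoid_side {n : ℕ} (A : Matrix (Fin n) (Fin n) ℝ) (hA : A.IsSymm)
    (π : Equiv.Perm (Fin n)) (hπ : IsRobinsonOrdering A π) (m a b : Fin n)
    (h : Relation.EqvGen (AvE A m) a b) : π a < π m ↔ π b < π m := by
  induction h with
  | refl => rfl
  | symm _ _ _ ih => exact ih.symm
  | trans _ _ _ _ _ ih1 ih2 => exact ih1.trans ih2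
  | rel a b h =>
    obtain ⟨ha, hb, h⟩ := h
    have ha' : π a ≠ π m := fun h => ha (π.injective h)
    have hb' : π b ≠ π m := fun h => hb (π.injective h)
    constructor
    · intro h1
      by_contra h2
      have := hπ a m b h1 (lt_of_le_of_ne (not_lt.mp h2) hb'.symm)
      rw [hA.apply m a] at this
      exact absurd h (not_lt.mpr this)
    · intro h1
      by_contra h2
      have := hπ b m a h1 (lt_of_le_of_ne (not_lt.mp h2) ha'.symm)
      rw [hA.apply m b, hA.apply a b, min_comm] at this
      exact absurd h (not_lt.mpr this)

lemma half {n : ℕ} (A : Matrix (Fin n) (Fin n) ℝ) (hA : A.IsSymm)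
    (hRob : IsRobinsonian A)
    (σ τ : Equiv.Perm (Fin n)) (hσ : IsSFSOrdering A σ) (hτ : IsSFSOrdering A τ)
    (x y z : Fin n) (hτ1 : τ x < τ y) (hτ2 : τ y < τ z)
    (hσ1 : σ z < σ y) (hσ2 : σ y < σ x) : A x z ≤ A x y := by
  by_contra hc
  have hc := not_le.mp hc
  obtain ⟨π, hπ⟩ := hRob
  have nxy : x ≠ y := fun h => hτ1.ne (by rw [h])
  have nyz : y ≠ z := fun h => hτ2.ne (by rw [h])
  have nxz : x ≠ z := fun h => (hτ1.trans hτ2).ne (by rw [h])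
  have p1 := sfs_path A hA τ hτ x y z hτ1 hτ2 hc
  have p2 : Relation.EqvGen (AvE A y) x z := .rel _ _ ⟨nxy, nyz.symm, by
    rw [hA.apply x y]; exact lt_of_le_of_lt (min_le_left _ _) hc⟩
  have p3 : Relation.EqvGen (AvE A x) z y := by
    by_cases h : A x y < A y z
    · exact .rel _ _ ⟨nxz.symm, nxy.symm, by
        rw [hA.apply y z]; exact lt_of_le_of_lt (min_le_right _ _) h⟩
    · refine sfs_path A hA σ hσ z y x hσ1 hσ2 ?_
      rw [hA.apply y z, hA.apply x z]
      exact lt_of_le_of_lt (not_lt.mp h) hc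
  have q1 := avoid_side A hA π hπ _ _ _ p1
  have q2 := avoid_side A hA π hπ _ _ _ p2
  have q3 := avoid_side A hA π hπ _ _ _ p3
  have e1 : π x ≠ π y := fun h => nxy (π.injective h)
  have e2 : π y ≠ π z := fun h => nyz (π.injective h)
  have e3 : π x ≠ π z := fun h => nxz (π.injective h)
  omega

/-- If `σ, τ` are two SFS orderings of a symmetric Robinsonian matrix `A`
with `x <_τ y <_τ z` and `z <_σ y <_σ x`, then the triple `(x, y, z)` is Robinson. -/
theorem stmt_10 {n : ℕ} (A : Matrix (Fin n) (Fin n) ℝ) (hA : A.IsSymm)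
    (hRob : IsRobinsonian A)
    (σ τ : Equiv.Perm (Fin n)) (hσ : IsSFSOrdering A σ) (hτ : IsSFSOrdering A τ)
    (x y z : Fin n) (hτ1 : τ x < τ y) (hτ2 : τ y < τ z)
    (hσ1 : σ z < σ y) (hσ2 : σ y < σ x) :
    A x z ≤ min (A x y) (A y z) := by
  refine le_min (half A hA hRob σ τ hσ hτ x y z hτ1 hτ2 hσ1 hσ2) ?_
  have := half A hA hRob τ σ hτ hσ z y x hσ1 hσ2 hτ1 hτ2
  rwa [hA.apply x z, hA.apply y z] at this
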